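/- A function Q ∈ S^{km}_{ℓ;ν}(ℝ^{2n+1}) satisfies L_{X_h} Q = 0 for every smooth function h on ℝ^{2n+1} (invariance under all contact vector fields) if and only if L_A Q = 0 for every A in the algebra sp_{2n+2} of infinitesimal projective contact transformations, i.e. for each of the generators X_1, X_{p_i}, X_{q^i}, X_t, X_{p_ip_j}, X_{q^iq^j}, X_{p_jq^i}, X_{tp_i}, X_{tq^i}, X_{t²}. (Over a Darboux chart, contact invariance of a tensor field is equivalent to sp_{2n+2}-invariance.) -/

import Mathlib

set_option linter.unusedVariables false

open scoped BigOperators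

noncomputable section

/-- Partial derivative of `f : ℝ^ι → ℝ` in the `i`-th coordinate direction. -/
def pd {ι : Type*} [Fintype ι] [DecidableEq ι] (i : ι) (f : (ι → ℝ) → ℝ) (x : ι → ℝ) : ℝ :=
  fderiv ℝ f x (Pi.single i 1)

/-- Index of the coordinate `p_i` in `ℝ^{2n+1}`. -/
def pIdx (n : ℕ) (i : Fin n) : Fin (2*n+1) := ⟨i.1, by have := i.isLt; omega⟩
/-- Index of the coordinate `q^i` in `ℝ^{2n+1}`. -/
def qIdx (n : ℕ) (i : Fin n) : Fin (2*n+1) := ⟨n + i.1, by have := i.isLt; omega⟩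
/-- Index of the coordinate `t` in `ℝ^{2n+1}`. -/
def tIdx (n : ℕ) : Fin (2*n+1) := ⟨2*n, by omega⟩

/-- The contact Hamiltonian vector field `X_h` of a function `h` on `ℝ^{2n+1}`:
`X_h = Σ_k (∂_{p_k}h ∂_{q^k} − ∂_{q^k}h ∂_{p_k}) + (ℰ_s h)∂_t − (∂_t h)ℰ_s − 2h∂_t`. -/
def contactHam (n : ℕ) (h : (Fin (2*n+1) → ℝ) → ℝ) (x : Fin (2*n+1) → ℝ) :
    Fin (2*n+1) → ℝ :=
  fun a =>
    if ha : a.1 < n then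
      -pd (qIdx n ⟨a.1, ha⟩) h x - pd (tIdx n) h x * x a
    else if ha' : a.1 < 2*n then
      pd (pIdx n ⟨a.1 - n, by omega⟩) h x - pd (tIdx n) h x * x a
    else
      (∑ k : Fin n, (x (pIdx n k) * pd (pIdx n k) h x + x (qIdx n k) * pd (qIdx n k) h x))
        - 2 * h x

/-- Points of `ℝ^{2n+1}`. -/
abbrev Vc (n : ℕ) : Type := Fin (2*n+1) → ℝ

/-- Partial derivative in the base variable `x`. -/
def pdX (n : ℕ) (i : Fin (2*n+1)) (Q : Vc n → Vc n → Vc n → Vc n → ℝ)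
    (x ξ η Y : Vc n) : ℝ :=
  fderiv ℝ (fun y => Q y ξ η Y) x (Pi.single i 1)

/-- Partial derivative in the fiber variable `ξ`. -/
def pdXi (n : ℕ) (i : Fin (2*n+1)) (Q : Vc n → Vc n → Vc n → Vc n → ℝ)
    (x ξ η Y : Vc n) : ℝ :=
  fderiv ℝ (fun ζ => Q x ζ η Y) ξ (Pi.single i 1)

/-- Partial derivative in the fiber variable `η`. -/
def pdEta (n : ℕ) (i : Fin (2*n+1)) (Q : Vc n → Vc n → Vc n → Vc n → ℝ)
    (x ξ η Y : Vc n) : ℝ :=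
  fderiv ℝ (fun ζ => Q x ξ ζ Y) η (Pi.single i 1)

/-- Partial derivative in the fiber variable `Y`. -/
def pdYv (n : ℕ) (i : Fin (2*n+1)) (Q : Vc n → Vc n → Vc n → Vc n → ℝ)
    (x ξ η Y : Vc n) : ℝ :=
  fderiv ℝ (fun ζ => Q x ξ η ζ) Y (Pi.single i 1)

/-- `Q` belongs to `S^{km}_{ℓ;ν}(ℝ^{2n+1})`: smooth in all variables and homogeneous of
degree `k` in `ξ`, `m` in `η`, `l` in `Y`. -/
def InS (n k m l : ℕ) (Q : Vc n → Vc n → Vc n → Vc n → ℝ) : Prop :=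
  ContDiff ℝ (⊤ : ℕ∞) (fun p : (Vc n × Vc n) × (Vc n × Vc n) => Q p.1.1 p.1.2 p.2.1 p.2.2) ∧
  (∀ x ξ η Y (c : ℝ), Q x (c • ξ) η Y = c ^ k * Q x ξ η Y) ∧
  (∀ x ξ η Y (c : ℝ), Q x ξ (c • η) Y = c ^ m * Q x ξ η Y) ∧
  (∀ x ξ η Y (c : ℝ), Q x ξ η (c • Y) = c ^ l * Q x ξ η Y)

/-- The action of a vector field `Xf` on `S^{km}_{ℓ;ν}`:
`L_X Q = X(Q) − Σ∂_jX^i η_i ∂_{η_j}Q − Σ∂_jX^i ξ_i ∂_{ξ_j}Q + Σ∂_jX^i Y^j ∂_{Y^i}Q + ν(div X)Q`. -/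
def LAct3 (n : ℕ) (ν : ℝ) (Xf : Vc n → Vc n) (Q : Vc n → Vc n → Vc n → Vc n → ℝ)
    (x ξ η Y : Vc n) : ℝ :=
  (∑ i, Xf x i * pdX n i Q x ξ η Y)
  - (∑ i, ∑ j, pd j (fun y => Xf y i) x * η i * pdEta n j Q x ξ η Y)
  - (∑ i, ∑ j, pd j (fun y => Xf y i) x * ξ i * pdXi n j Q x ξ η Y)
  + (∑ i, ∑ j, pd j (fun y => Xf y i) x * Y j * pdYv n i Q x ξ η Y)
  + ν * (∑ i, pd i (fun y => Xf y i) x) * Q x ξ η Y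

/-- `u_1 = ⟨Y,ξ⟩`. -/
def u1 (n : ℕ) (x ξ η Y : Vc n) : ℝ := ∑ i, Y i * ξ i
/-- `u_2 = ⟨Y,η⟩`. -/
def u2 (n : ℕ) (x ξ η Y : Vc n) : ℝ := ∑ i, Y i * η i
/-- `u_3 = α(Y)`. -/
def u3 (n : ℕ) (x ξ η Y : Vc n) : ℝ :=
  (1/2) * ((∑ k : Fin n, (x (pIdx n k) * Y (qIdx n k) - x (qIdx n k) * Y (pIdx n k)))
    - Y (tIdx n))
/-- `u_4 = −2ξ_t`. -/
def u4 (n : ℕ) (x ξ η Y : Vc n) : ℝ := -2 * ξ (tIdx n)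
/-- `u_5 = −2η_t`. -/
def u5 (n : ℕ) (x ξ η Y : Vc n) : ℝ := -2 * η (tIdx n)
/-- `L_1 = Σ_k (ξ_{p_k}η_{q^k} − ξ_{q^k}η_{p_k}) + η_t⟨ℰ_s,ξ_s⟩ − ξ_t⟨ℰ_s,η_s⟩`. -/
def L1p (n : ℕ) (x ξ η Y : Vc n) : ℝ :=
  (∑ k : Fin n, (ξ (pIdx n k) * η (qIdx n k) - ξ (qIdx n k) * η (pIdx n k)))
  + η (tIdx n) * (∑ k : Fin n, (x (pIdx n k) * ξ (pIdx n k) + x (qIdx n k) * ξ (qIdx n k)))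
  - ξ (tIdx n) * (∑ k : Fin n, (x (pIdx n k) * η (pIdx n k) + x (qIdx n k) * η (qIdx n k)))

/-- Contact Hamiltonians of the generators of `sp_{2n+2}`: the functions
`1, p_i, q^i, t, p_ip_j, q^iq^j, p_jq^i, tp_i, tq^i, t²`. -/
def IsGen (n : ℕ) (h : Vc n → ℝ) : Prop :=
  h = (fun _ => 1) ∨
  (∃ i, h = fun x => x (pIdx n i)) ∨
  (∃ i, h = fun x => x (qIdx n i)) ∨
  h = (fun x => x (tIdx n)) ∨
  (∃ i j, h = fun x => x (pIdx n i) * x (pIdx n j)) ∨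
  (∃ i j, h = fun x => x (qIdx n i) * x (qIdx n j)) ∨
  (∃ i j, h = fun x => x (pIdx n j) * x (qIdx n i)) ∨
  (∃ i, h = fun x => x (tIdx n) * x (pIdx n i)) ∨
  (∃ i, h = fun x => x (tIdx n) * x (qIdx n i)) ∨
  h = (fun x => x (tIdx n) * x (tIdx n))

section Pd

variable {ι : Type*} [Fintype ι] [DecidableEq ι] {f g : (ι → ℝ) → ℝ} {x : ι → ℝ}

lemma pd_add (i : ι) (hf : DifferentiableAt ℝ f x) (hg : DifferentiableAt ℝ g x) :
    pd i (fun y => f y + g y) x = pd i f x + pd i g x := by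
  simp [pd, fderiv_fun_add hf hg]

lemma pd_const_mul (i : ι) (c : ℝ) (hf : DifferentiableAt ℝ f x) :
    pd i (fun y => c * f y) x = c * pd i f x := by
  simp [pd, fderiv_const_mul hf]

lemma contDiff_pd (i : ι) (hf : ContDiff ℝ (⊤ : ℕ∞) f) : ContDiff ℝ (⊤ : ℕ∞) (pd i f) :=
  (hf.fderiv_right (m := (⊤ : ℕ∞)) (by simp)).clm_apply contDiff_const

lemma pd_eq_fderiv_fderiv (hf : ContDiff ℝ (⊤ : ℕ∞) f) (i j : ι) (x : ι → ℝ) :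
    pd i (pd j f) x = fderiv ℝ (fderiv ℝ f) x (Pi.single i 1) (Pi.single j 1) := by
  have hd : DifferentiableAt ℝ (fderiv ℝ f) x :=
    (hf.fderiv_right (m := (⊤ : ℕ∞)) (by simp)).differentiable (by simp) x
  unfold pd
  rw [fderiv_clm_apply hd (differentiableAt_const _)]
  simp

end Pd

/-- The second-order Taylor polynomial of `h` at `x`. -/
def taylorTwo {n : ℕ} (h : Vc n → ℝ) (x y : Vc n) : ℝ :=
  h x + fderiv ℝ h x (y - x) + (1 / 2) * fderiv ℝ (fderiv ℝ h) x (y - x) (y - x)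

lemma contDiff_taylorTwo {n : ℕ} (h : Vc n → ℝ) (x : Vc n) :
    ContDiff ℝ (⊤ : ℕ∞) (taylorTwo h x) := by
  unfold taylorTwo
  fun_prop

lemma pd_taylorTwo {n : ℕ} {h : Vc n → ℝ} (hh : ContDiff ℝ (⊤ : ℕ∞) h) (x y : Vc n)
    (i : Fin (2 * n + 1)) :
    pd i (taylorTwo h x) y =
      pd i h x + fderiv ℝ (fderiv ℝ h) x (y - x) (Pi.single i 1) := by
  have hsymm : IsSymmSndFDerivAt ℝ h x := by
    refine hh.contDiffAt.isSymmSndFDerivAt ?_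
    rw [minSmoothness_of_isRCLikeNormedField]
    exact WithTop.coe_le_coe.2 le_top
  have hs : HasFDerivAt (fun y : Vc n => y - x) (ContinuousLinearMap.id ℝ (Vc n)) y :=
    (hasFDerivAt_id y).sub_const x
  have hB := ((fderiv ℝ (fderiv ℝ h) x).hasFDerivAt.comp y hs).clm_apply hs
  have hT := (((fderiv ℝ h x).hasFDerivAt.comp y hs).const_add (h x)).add (hB.const_mul (1 / 2))
  have key := congrArg (fun L => L (Pi.single i 1)) hT.fderiv
  have e : pd i (taylorTwo h x) y = _ := key
  rw [e]
  have hflip := hsymm.eq (Pi.single i 1) (y - x)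
  simp only [pd, add_apply, smul_apply, ContinuousLinearMap.comp_apply,
    ContinuousLinearMap.id_apply, ContinuousLinearMap.flip_apply, Function.comp_apply, smul_eq_mul,
    hflip]
  ring

lemma pd_pd_taylorTwo {n : ℕ} {h : Vc n → ℝ} (hh : ContDiff ℝ (⊤ : ℕ∞) h) (x : Vc n)
    (i j : Fin (2 * n + 1)) :
    pd i (pd j (taylorTwo h x)) x = pd i (pd j h) x := by
  rw [pd_eq_fderiv_fderiv hh, funext fun y => pd_taylorTwo hh x y j]
  have hs : HasFDerivAt (fun y : Vc n => y - x) (ContinuousLinearMap.id ℝ (Vc n)) x :=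
    (hasFDerivAt_id x).sub_const x
  have hB := (((fderiv ℝ (fderiv ℝ h) x).hasFDerivAt.comp x hs).clm_apply
    (hasFDerivAt_const (Pi.single j 1) x)).const_add (pd j h x)
  have e := congrArg (fun L => L (Pi.single i 1)) hB.fderiv
  refine Eq.trans e ?_
  simp

lemma contDiff_contactHam {n : ℕ} {h : Vc n → ℝ} (hh : ContDiff ℝ (⊤ : ℕ∞) h)
    (a : Fin (2 * n + 1)) : ContDiff ℝ (⊤ : ℕ∞) (fun y => contactHam n h y a) := by
  have hp := fun i => contDiff_pd i hh
  unfold contactHam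
  split_ifs <;> fun_prop

lemma differentiableAt_contactHam {n : ℕ} {h : Vc n → ℝ} (hh : ContDiff ℝ (⊤ : ℕ∞) h)
    (a : Fin (2 * n + 1)) (x : Vc n) : DifferentiableAt ℝ (fun y => contactHam n h y a) x :=
  (contDiff_contactHam hh a).differentiable (by simp) x

lemma contactHam_add {n : ℕ} {f g : Vc n → ℝ} (hf : ContDiff ℝ (⊤ : ℕ∞) f)
    (hg : ContDiff ℝ (⊤ : ℕ∞) g) (y : Vc n) (a : Fin (2 * n + 1)) :
    contactHam n (f + g) y a = contactHam n f y a + contactHam n g y a := by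
  have hp : ∀ i, pd i (f + g) y = pd i f y + pd i g y := fun i =>
    pd_add i (hf.differentiable (by simp) y) (hg.differentiable (by simp) y)
  simp only [contactHam, hp, Pi.add_apply]
  split_ifs
  · ring
  · ring
  · simp only [mul_add, Finset.sum_add_distrib]
    ring

lemma contactHam_smul {n : ℕ} {f : Vc n → ℝ} (hf : ContDiff ℝ (⊤ : ℕ∞) f) (c : ℝ)
    (y : Vc n) (a : Fin (2 * n + 1)) :
    contactHam n (c • f) y a = c * contactHam n f y a := by
  have hp : ∀ i, pd i (c • f) y = c * pd i f y := fun i =>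
    pd_const_mul i c (hf.differentiable (by simp) y)
  simp only [contactHam, hp, Pi.smul_apply, smul_eq_mul]
  split_ifs
  · ring
  · ring
  · simp only [mul_sub, Finset.mul_sum]
    congr 1
    · exact Finset.sum_congr rfl fun k _ => by ring
    · ring

/-- The smooth Hamiltonians `h` for which `L_{X_h} Q` vanishes at the given point. -/
def invariantHamiltonians (n : ℕ) (ν : ℝ) (Q : Vc n → Vc n → Vc n → Vc n → ℝ)
    (x ξ η Y : Vc n) : Submodule ℝ (Vc n → ℝ) where
  carrier := {h | ContDiff ℝ (⊤ : ℕ∞) h ∧ LAct3 n ν (contactHam n h) Q x ξ η Y = 0}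
  zero_mem' := by
    refine ⟨contDiff_const, ?_⟩
    have h0 : contactHam n 0 = 0 := by
      funext y a
      simpa using contactHam_smul (f := 0) contDiff_const 0 y a
    simp [h0, LAct3, pd]
  add_mem' := by
    rintro f g ⟨hf, hf0⟩ ⟨hg, hg0⟩
    refine ⟨hf.add hg, ?_⟩
    have hp : ∀ i j, pd j (fun y => contactHam n (f + g) y i) x =
        pd j (fun y => contactHam n f y i) x + pd j (fun y => contactHam n g y i) x := by
      intro i j
      simp only [contactHam_add hf hg]
      exact pd_add j (differentiableAt_contactHam hf i x) (differentiableAt_contactHam hg i x)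
    unfold LAct3 at hf0 hg0 ⊢
    simp only [hp]
    simp only [contactHam_add hf hg, add_mul, Finset.sum_add_distrib]
    linear_combination hf0 + hg0
  smul_mem' := by
    rintro c f ⟨hf, hf0⟩
    refine ⟨contDiff_const.smul hf, ?_⟩
    have hp : ∀ i j, pd j (fun y => contactHam n (c • f) y i) x =
        c * pd j (fun y => contactHam n f y i) x := by
      intro i j
      simp only [contactHam_smul hf]
      exact pd_const_mul j c (differentiableAt_contactHam hf i x)
    unfold LAct3 at hf0 ⊢
    simp only [hp]
    simp only [contactHam_smul hf, mul_assoc, ← Finset.mul_sum] at hf0 ⊢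
    linear_combination c * hf0

lemma pd_coord_mul_eq_zero {n : ℕ} {f : Vc n → ℝ} {x : Vc n} (hf : DifferentiableAt ℝ f x)
    (hx : f x = 0) (a j : Fin (2 * n + 1)) (hj : pd j f x = 0) :
    pd j (fun y => f y * y a) x = 0 := by
  have ha : DifferentiableAt ℝ (fun y : Vc n => y a) x := by fun_prop
  unfold pd at hj ⊢
  rw [fderiv_fun_mul hf ha]
  simp [hx, hj]

/-- `L_{X_h} Q` only depends on the 2-jet of `h`: it vanishes where that jet does. -/
lemma mem_invariantHamiltonians_of_jet_eq_zero {n : ℕ} (ν : ℝ)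
    (Q : Vc n → Vc n → Vc n → Vc n → ℝ) (x ξ η Y : Vc n) {g : Vc n → ℝ}
    (hg : ContDiff ℝ (⊤ : ℕ∞) g) (h0 : g x = 0) (h1 : ∀ i, pd i g x = 0)
    (h2 : ∀ i j, pd i (pd j g) x = 0) : g ∈ invariantHamiltonians n ν Q x ξ η Y := by
  refine ⟨hg, ?_⟩
  have hd : ∀ i, DifferentiableAt ℝ (pd i g) x := fun i =>
    (contDiff_pd i hg).differentiable (by simp) x
  have hgd : DifferentiableAt ℝ g x := hg.differentiable (by simp) x
  have hm : ∀ i a, DifferentiableAt ℝ (fun y : Vc n => pd i g y * y a) x := fun i a =>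
    (hd i).mul (by fun_prop)
  have hz : ∀ i a j, fderiv ℝ (fun y : Vc n => pd i g y * y a) x (Pi.single j 1) = 0 :=
    fun i a j => pd_coord_mul_eq_zero (hd i) (h1 i) a j (h2 j i)
  have hv : ∀ i, contactHam n g x i = 0 := by
    intro i
    unfold contactHam
    split_ifs <;> simp [h0, h1]
  have hp : ∀ i j, pd j (fun y => contactHam n g y i) x = 0 := by
    intro i j
    have h2' : ∀ a, fderiv ℝ (pd a g) x (Pi.single j 1) = 0 := fun a => h2 j a
    have h1' : fderiv ℝ g x (Pi.single j 1) = 0 := h1 j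
    unfold contactHam
    split_ifs
    · rw [pd, fderiv_fun_sub (hd _).fun_neg (hm _ _), fderiv_fun_neg]
      simp [h2', hz]
    · rw [pd, fderiv_fun_sub (hd _) (hm _ _)]
      simp [h2', hz]
    · simp only [mul_comm _ (pd _ g _)]
      rw [pd, fderiv_fun_sub
        (DifferentiableAt.fun_sum fun k _ => (hm _ _).fun_add (hm _ _)) (hgd.const_mul 2),
        fderiv_fun_sum fun k _ => (hm _ _).fun_add (hm _ _), fderiv_const_mul hgd]
      simp [fderiv_fun_add (hm _ _) (hm _ _), hz, h1']
  simp [LAct3, hv, hp]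

lemma eq_pIdx_or_qIdx_or_tIdx {n : ℕ} (a : Fin (2 * n + 1)) :
    (∃ i, a = pIdx n i) ∨ (∃ i, a = qIdx n i) ∨ a = tIdx n := by
  by_cases h : a.1 < n
  · exact Or.inl ⟨⟨a.1, h⟩, rfl⟩
  by_cases h' : a.1 < 2 * n
  · exact Or.inr (Or.inl ⟨⟨a.1 - n, by omega⟩, Fin.ext (by simp only [qIdx]; omega)⟩)
  · exact Or.inr (Or.inr (Fin.ext (by simp only [tIdx]; omega)))

lemma isGen_coord {n : ℕ} (a : Fin (2 * n + 1)) : IsGen n (fun x => x a) := by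
  unfold IsGen
  rcases eq_pIdx_or_qIdx_or_tIdx a with ⟨i, rfl⟩ | ⟨i, rfl⟩ | rfl
  · exact Or.inr (Or.inl ⟨i, rfl⟩)
  · exact Or.inr (Or.inr (Or.inl ⟨i, rfl⟩))
  · exact Or.inr (Or.inr (Or.inr (Or.inl rfl)))

lemma isGen_coord_mul_coord {n : ℕ} (a b : Fin (2 * n + 1)) :
    IsGen n (fun x => x a * x b) := by
  unfold IsGen
  iterate 4 right
  rcases eq_pIdx_or_qIdx_or_tIdx a with ⟨i, rfl⟩ | ⟨i, rfl⟩ | rfl <;>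
    rcases eq_pIdx_or_qIdx_or_tIdx b with ⟨j, rfl⟩ | ⟨j, rfl⟩ | rfl
  · exact Or.inl ⟨i, j, rfl⟩
  · exact Or.inr (Or.inr (Or.inl ⟨j, i, rfl⟩))
  · exact Or.inr (Or.inr (Or.inr (Or.inl ⟨i, funext fun x => mul_comm _ _⟩)))
  · exact Or.inr (Or.inr (Or.inl ⟨i, j, funext fun x => mul_comm _ _⟩))
  · exact Or.inr (Or.inl ⟨i, j, rfl⟩)
  · exact Or.inr (Or.inr (Or.inr (Or.inr (Or.inl ⟨i, funext fun x => mul_comm _ _⟩))))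
  · exact Or.inr (Or.inr (Or.inr (Or.inl ⟨j, rfl⟩)))
  · exact Or.inr (Or.inr (Or.inr (Or.inr (Or.inl ⟨j, rfl⟩))))
  · exact Or.inr (Or.inr (Or.inr (Or.inr (Or.inr rfl))))

lemma IsGen.contDiff {n : ℕ} {h : Vc n → ℝ} (hh : IsGen n h) : ContDiff ℝ (⊤ : ℕ∞) h := by
  rcases hh with rfl | ⟨i, rfl⟩ | ⟨i, rfl⟩ | rfl | ⟨i, j, rfl⟩ | ⟨i, j, rfl⟩ | ⟨i, j, rfl⟩ |
    ⟨i, rfl⟩ | ⟨i, rfl⟩ | rfl <;> fun_prop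

lemma clm_apply_eq_sum {n : ℕ} {F : Type*} [NormedAddCommGroup F] [NormedSpace ℝ F]
    (L : Vc n →L[ℝ] F) (y : Vc n) : L y = ∑ i, y i • L (Pi.single i 1) := by
  conv_lhs => rw [pi_eq_sum_univ' y]
  simp [map_sum]

/-- A space of functions containing the generators of `sp_{2n+2}` contains every polynomial of
degree at most two. -/
lemma taylorTwo_mem_of_isGen {n : ℕ} {V : Submodule ℝ (Vc n → ℝ)}
    (hV : ∀ h, IsGen n h → h ∈ V) (h : Vc n → ℝ) (x : Vc n) : taylorTwo h x ∈ V := by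
  have hone (c : ℝ) : (fun _ => c) ∈ V := by
    convert V.smul_mem c (hV _ (Or.inl rfl)) using 1
    funext y
    simp
  have hlin (L : Vc n →L[ℝ] ℝ) : (fun y => L y) ∈ V := by
    convert V.sum_mem (t := Finset.univ) fun i _ =>
      V.smul_mem (L (Pi.single i 1)) (hV _ (isGen_coord i)) using 1
    funext y
    rw [clm_apply_eq_sum L y]
    simp [mul_comm]
  have hquad (B : Vc n →L[ℝ] Vc n →L[ℝ] ℝ) : (fun y => B y y) ∈ V := by
    convert V.sum_mem (t := Finset.univ) fun i _ => V.sum_mem (t := Finset.univ) fun j _ =>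
      V.smul_mem (B (Pi.single i 1) (Pi.single j 1)) (hV _ (isGen_coord_mul_coord i j)) using 1
    funext y
    conv_lhs => rw [clm_apply_eq_sum B y]
    simp only [sum_apply, smul_apply, Finset.sum_apply,
      Pi.smul_apply, smul_eq_mul]
    refine Finset.sum_congr rfl fun i _ => ?_
    rw [clm_apply_eq_sum (B (Pi.single i 1)) y, Finset.mul_sum]
    refine Finset.sum_congr rfl fun j _ => ?_
    rw [smul_eq_mul]
    ring
  set L := fderiv ℝ h x
  set B := fderiv ℝ (fderiv ℝ h) x
  convert V.add_mem (V.add_mem (hone (h x - L x + (1 / 2) * B x x))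
    (hlin (L - (1 / 2 : ℝ) • (B x + B.flip x)))) (V.smul_mem (1 / 2 : ℝ) (hquad B)) using 1
  funext y
  simp [taylorTwo, L, B]
  ring

/-- Over a Darboux chart, a tensor field `Q ∈ S^{km}_{ℓ;ν}` is invariant under all
contact vector fields iff it is invariant under the algebra `sp_{2n+2}` of infinitesimal
projective contact transformations. -/
theorem stmt16 (n : ℕ) (hn : 1 ≤ n) (k m l : ℕ) (ν : ℝ)
    (Q : Vc n → Vc n → Vc n → Vc n → ℝ) (hQ : InS n k m l Q) :
    (∀ h : Vc n → ℝ, ContDiff ℝ (⊤ : ℕ∞) h →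
      ∀ x ξ η Y, LAct3 n ν (contactHam n h) Q x ξ η Y = 0)
    ↔ (∀ h, IsGen n h → ∀ x ξ η Y, LAct3 n ν (contactHam n h) Q x ξ η Y = 0) := by
  constructor
  · exact fun H h hh => H h hh.contDiff
  · intro H h hh x ξ η Y
    have hT : taylorTwo h x ∈ invariantHamiltonians n ν Q x ξ η Y :=
      taylorTwo_mem_of_isGen
        (V := invariantHamiltonians n ν Q x ξ η Y)
        (fun g hg => And.intro hg.contDiff (H g hg x ξ η Y)) h x
    have hd : ∀ y, DifferentiableAt ℝ h y := fun y => hh.differentiable (by simp) y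
    have hTd : ∀ y, DifferentiableAt ℝ (taylorTwo h x) y := fun y =>
      (contDiff_taylorTwo h x).differentiable (by simp) y
    have hpd : ∀ i, pd i (h - taylorTwo h x) = pd i h - pd i (taylorTwo h x) := by
      intro i
      funext y
      simp [pd, fderiv_sub (hd y) (hTd y)]
    have hR : h - taylorTwo h x ∈ invariantHamiltonians n ν Q x ξ η Y := by
      refine mem_invariantHamiltonians_of_jet_eq_zero ν Q x ξ η Y
        (hh.sub (contDiff_taylorTwo h x)) (by simp [taylorTwo]) (fun i => ?_) (fun i j => ?_)
      · simp [hpd, pd_taylorTwo hh]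
      · rw [hpd, pd, fderiv_sub ((contDiff_pd j hh).differentiable (by simp) x)
          ((contDiff_pd j (contDiff_taylorTwo h x)).differentiable (by simp) x)]
        exact sub_eq_zero.2 (pd_pd_taylorTwo hh x i j).symm
    have hsum := Submodule.add_mem _ hR hT
    rw [sub_add_cancel] at hsum
    exact hsum.2
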